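/- Let n ≥ 3 be an integer and set m = ⌊n/2⌋. Define e_{n−1} on (n−1)-tuples of reals by e_{n−1}(v) = ∫_{(0,∞)^{n+1}} ((1 + k1 + Σ_{i=1}^{n−1} hi·vi²)(1 + k2 + Σ_{i=1}^{n−1} hi) − (1 + Σ_{i=1}^{n−1} hi·vi)²)^(−(n+2)/2) dk dh. Let u1,…,u_{m−1}, u_{m+1},…,u_n be real numbers with 1 < u1 < … < u_{m−1} < u_{m+1} < … < u_n (the index m is omitted), and set u0 = 1 and u_{−1} = 0. Then e_{n−1}(A) = (u_n − u_{n−1})^n · e_{n−1}(u1, …, u_{m−1}, u_{m+1}, …, u_n), where A is the (n−1)-tuple whose entries are the numbers (u_n − u_j)/(u_n − u_{n−1}) for j = n−2, n−3, …, 1, 0, −1 taken in this order, with the entry corresponding to j = m omitted. -/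

import Mathlib

open MeasureTheory

/-- The function `e_m` of the paper: for `v ∈ ℝ^m`,
`e_m(v) = ∫_{(0,∞)^{m+2}} ((1 + k1 + Σᵢ hᵢvᵢ²)(1 + k2 + Σᵢ hᵢ) − (1 + Σᵢ hᵢvᵢ)²)^(−(m+3)/2)
dk dh`;  for `m = n − 1` the exponent is `−(n+2)/2`. -/
noncomputable def eFun (m : ℕ) (v : Fin m → ℝ) : ℝ :=
  ∫ p in ((Set.Ioi (0:ℝ) ×ˢ Set.Ioi (0:ℝ)) ×ˢ
      ((Set.univ : Set (Fin m)).pi fun _ => Set.Ioi (0:ℝ))),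
    ((1 + p.1.1 + ∑ i, p.2 i * v i ^ 2) * (1 + p.1.2 + ∑ i, p.2 i)
        - (1 + ∑ i, p.2 i * v i) ^ 2) ^ (-((m : ℝ) + 3) / 2)

namespace EulerR

open MeasureTheory Set
open scoped ENNReal

/-- projective change of chart, in `lintegral` form -/
lemma proj_chart {E : Type*} [NormedAddCommGroup E] [NormedSpace ℝ E] [MeasurableSpace E]
    [BorelSpace E] [FiniteDimensional ℝ E] (μ : Measure E) [μ.IsAddHaarMeasure]
    (F : ℝ → ℝ → E → ℝ≥0∞)
    (hF : ∀ r : ℝ, 0 < r → ∀ a b : ℝ, 0 < a → 0 < b → ∀ y : E, F (r * a) (r * b) (r • y)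
      = ENNReal.ofReal ((r ^ (Module.finrank ℝ E + 2))⁻¹) * F a b y) :
    ∫⁻ t in Ioi (0:ℝ), ∫⁻ y, F 1 t y ∂μ = ∫⁻ t in Ioi (0:ℝ), ∫⁻ y, F t 1 y ∂μ := by
  have himg : (fun t : ℝ => t⁻¹) '' Ioi (0:ℝ) = Ioi 0 := by
    ext t
    simp only [mem_image, mem_Ioi]
    constructor
    · rintro ⟨s, hs, rfl⟩
      positivity
    · intro ht
      exact ⟨t⁻¹, by positivity, inv_inv t⟩
  have key := lintegral_image_eq_lintegral_abs_deriv_mul (s := Ioi (0:ℝ)) (f := fun t : ℝ => t⁻¹)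
    (f' := fun t => -(t ^ 2)⁻¹) measurableSet_Ioi
    (fun x hx => (hasDerivAt_inv (ne_of_gt hx)).hasDerivWithinAt)
    (fun x _ y _ h => inv_injective h) (fun t => ∫⁻ y, F t 1 y ∂μ)
  rw [himg] at key
  rw [key]
  refine setLIntegral_congr_fun measurableSet_Ioi ?_
  intro t ht
  have ht : 0 < t := ht
  have h1 : ∀ y : E, F 1 t y
      = ENNReal.ofReal ((t ^ (Module.finrank ℝ E + 2))⁻¹) * F t⁻¹ 1 (t⁻¹ • y) := by
    intro y
    have := hF t ht t⁻¹ 1 (by positivity) one_pos (t⁻¹ • y)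
    rwa [mul_inv_cancel₀ ht.ne', mul_one, smul_inv_smul₀ ht.ne'] at this
  have h2 : ∫⁻ y, F t⁻¹ 1 (t⁻¹ • y) ∂μ
      = ENNReal.ofReal (t ^ Module.finrank ℝ E) * ∫⁻ y, F t⁻¹ 1 y ∂μ := by
    have hm := Measure.map_addHaar_smul μ (r := t⁻¹) (by positivity)
    have := lintegral_map_equiv (μ := μ) (fun y => F t⁻¹ 1 y)
      (Homeomorph.smulOfNeZero (α := E) t⁻¹ (by positivity)).toMeasurableEquiv
    have e : ⇑(Homeomorph.smulOfNeZero (α := E) t⁻¹ (by positivity)).toMeasurableEquiv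
      = (t⁻¹ • ·) := rfl
    rw [e, hm, lintegral_smul_measure] at this
    rw [← this]
    rw [smul_eq_mul, inv_pow, inv_inv, abs_of_pos (by positivity)]
  simp only [h1]
  rw [lintegral_const_mul' _ _ ENNReal.ofReal_ne_top, h2, ← mul_assoc,
    ← ENNReal.ofReal_mul (by positivity)]
  congr 2
  rw [abs_neg, abs_of_pos (by positivity), pow_add]
  field_simp

abbrev EE (N : ℕ) := ℝ × (ℝ × (ℝ × (Fin N → ℝ)))

def posS (N : ℕ) : Set (EE N) :=
  Ioi 0 ×ˢ (Ioi 0 ×ˢ (Ioi 0 ×ˢ (univ.pi fun _ => Ioi (0:ℝ))))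

lemma measurable_posS (N : ℕ) : MeasurableSet (posS N) :=
  measurableSet_Ioi.prod (measurableSet_Ioi.prod (measurableSet_Ioi.prod
    (MeasurableSet.univ_pi fun _ => measurableSet_Ioi)))

/-- the homogeneous determinant; the points are `∞, Y, 0, x, 1, X` -/
def DD {N : ℕ} (x : Fin N → ℝ) (X Y a b : ℝ) (y : EE N) : ℝ :=
  (y.1 + a + b * X ^ 2 + y.2.1 * Y ^ 2 + ∑ i, y.2.2.2 i * x i ^ 2)
    * (y.2.2.1 + a + b + y.2.1 + ∑ i, y.2.2.2 i)
    - (a + b * X + y.2.1 * Y + ∑ i, y.2.2.2 i * x i) ^ 2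

noncomputable def FF {N : ℕ} (s : ℝ) (x : Fin N → ℝ) (X Y a b : ℝ) (y : EE N) : ℝ≥0∞ :=
  (posS N).indicator (fun y => ENNReal.ofReal (DD x X Y a b y ^ s)) y

lemma cs2 (A B C p q r : ℝ) (hA : 0 ≤ A) (hC : 0 ≤ C) (hB : B ^ 2 ≤ A * C)
    (hp : 0 ≤ p) (hr : 0 ≤ r) (hq : q ^ 2 ≤ p * r) :
    (B + q) ^ 2 ≤ (A + p) * (C + r) := by
  have h := Finset.sum_sq_le_sum_mul_sum_of_sq_le_mul (Finset.univ : Finset (Fin 2))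
    (r := ![B, q]) (f := ![A, p]) (g := ![C, r])
    (by intro i _; fin_cases i <;> simpa) (by intro i _; fin_cases i <;> simpa)
    (by intro i _; fin_cases i <;> simpa)
  simpa [Fin.sum_univ_two] using h

lemma DD_nonneg {N : ℕ} (x : Fin N → ℝ) (X Y a b : ℝ) (y : EE N) (ha : 0 < a) (hb : 0 < b)
    (hy : y ∈ posS N) : 0 ≤ DD x X Y a b y := by
  obtain ⟨h1, h2, h3, h4⟩ := hy
  have h1 : 0 < y.1 := h1
  have h2 : 0 < y.2.1 := h2
  have h3 : 0 < y.2.2.1 := h3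
  have h4 : ∀ i, 0 < y.2.2.2 i := fun i => h4 i (mem_univ i)
  have hs : (∑ i, y.2.2.2 i * x i) ^ 2 ≤ (∑ i, y.2.2.2 i * x i ^ 2) * ∑ i, y.2.2.2 i := by
    apply Finset.sum_sq_le_sum_mul_sum_of_sq_le_mul
    · intro i _; have := h4 i; positivity
    · intro i _; exact (h4 i).le
    · intro i _; exact le_of_eq (by ring)
  have n2 : 0 ≤ ∑ i, y.2.2.2 i * x i ^ 2 :=
    Finset.sum_nonneg fun i _ => by have := h4 i; positivity
  have n0 : 0 ≤ ∑ i, y.2.2.2 i := Finset.sum_nonneg fun i _ => (h4 i).le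
  have c1 := cs2 _ _ _ a a a n2 n0 hs ha.le ha.le (by nlinarith)
  have c2 := cs2 _ _ _ (b * X ^ 2) (b * X) b (by positivity) (by positivity) c1
    (by positivity) hb.le (by nlinarith)
  have c3 := cs2 _ _ _ (y.2.1 * Y ^ 2) (y.2.1 * Y) y.2.1 (by positivity) (by positivity) c2
    (by positivity) h2.le (by nlinarith)
  have c4 := cs2 _ _ _ y.1 0 y.2.2.1 (by positivity) (by positivity) c3
    h1.le h3.le (by nlinarith [mul_pos h1 h3])
  unfold DD
  nlinarith [c4]

lemma FF_hom {N : ℕ} (x : Fin N → ℝ) (X Y : ℝ) (r : ℝ) (hr : 0 < r) (a b : ℝ)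
    (ha : 0 < a) (hb : 0 < b) (y : EE N) :
    FF (-(((N + 2 : ℕ) : ℝ) + 3) / 2) x X Y (r * a) (r * b) (r • y)
      = ENNReal.ofReal ((r ^ (Module.finrank ℝ (EE N) + 2))⁻¹)
        * FF (-(((N + 2 : ℕ) : ℝ) + 3) / 2) x X Y a b y := by
  have hmem : r • y ∈ posS N ↔ y ∈ posS N := by
    simp [posS, mem_prod, hr, mem_pi]
  by_cases hy : y ∈ posS N
  · have hD : DD x X Y (r * a) (r * b) (r • y) = r ^ 2 * DD x X Y a b y := by
      simp only [DD, Prod.smul_fst, Prod.smul_snd, smul_eq_mul, Pi.smul_apply, mul_assoc,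
        ← Finset.mul_sum]
      ring
    rw [FF, FF, indicator_of_mem hy, indicator_of_mem (hmem.2 hy),
      ← ENNReal.ofReal_mul (by positivity), hD,
      Real.mul_rpow (by positivity) (DD_nonneg x X Y a b y ha hb hy)]
    congr 2
    have hf : Module.finrank ℝ (EE N) = N + 3 := by
      simp [EE]; ring
    rw [hf, ← Real.rpow_natCast r 2, ← Real.rpow_mul hr.le, ← Real.rpow_natCast r,
      ← Real.rpow_neg hr.le]
    congr 1
    push_cast
    ring
  · rw [FF, FF, indicator_of_notMem hy, indicator_of_notMem (hmem.not.2 hy), mul_zero]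

section shuffle
variable {α β γ : Type*} [MeasureSpace α] [MeasureSpace β] [MeasureSpace γ]
  [SigmaFinite (volume : Measure α)] [SigmaFinite (volume : Measure β)]
  [SigmaFinite (volume : Measure γ)]

lemma mp_lc : MeasurePreserving (fun p : α × (β × γ) => (p.2.1, (p.1, p.2.2)))
    volume volume := by
  have h1 := (volume_preserving_prodAssoc (α₁ := α) (β₁ := β) (γ₁ := γ)).symm
  have h2 : MeasurePreserving (Prod.map Prod.swap id : (α × β) × γ → (β × α) × γ)
    volume volume :=
    (Measure.measurePreserving_swap (μ := (volume : Measure α)) (ν := (volume : Measure β))).prod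
      (MeasurePreserving.id volume)
  have h3 := (volume_preserving_prodAssoc (α₁ := β) (β₁ := α) (γ₁ := γ))
  exact h3.comp (h2.comp h1)

lemma mp_right {f : β → γ} (hf : MeasurePreserving f volume volume) :
    MeasurePreserving (fun p : α × β => (p.1, f p.2)) volume volume :=
  (MeasurePreserving.id (volume : Measure α)).prod hf

end shuffle

def phi (N : ℕ) (p : (ℝ × ℝ) × (Fin (N + 2) → ℝ)) : ℝ × EE N :=
  (p.2 (Fin.last N).castSucc, (p.1.1, (p.2 (Fin.last (N + 1)), (p.1.2,
    fun i => p.2 i.castSucc.castSucc))))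

lemma mp_last (N : ℕ) : MeasurePreserving
    (fun h : Fin (N + 1) → ℝ => (h (Fin.last N), fun i : Fin N => h i.castSucc))
    volume volume := by
  have := volume_preserving_piFinSuccAbove (fun _ : Fin (N + 1) => ℝ) (Fin.last N)
  have e : (fun h : Fin (N + 1) → ℝ => (h (Fin.last N), fun i : Fin N => h i.castSucc))
      = ⇑(MeasurableEquiv.piFinSuccAbove (fun _ : Fin (N + 1) => ℝ) (Fin.last N)) := by
    funext h
    simp [MeasurableEquiv.piFinSuccAbove, Fin.insertNthEquiv]
    rfl
  rw [e]
  exact this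

lemma mp_phi (N : ℕ) : MeasurePreserving (phi N) volume volume := by
  have h1 := mp_right (α := ℝ × ℝ) (mp_last (N + 1))
  have h2 := mp_right (α := ℝ × ℝ) (mp_right (α := ℝ) (mp_last N))
  have h3 := volume_preserving_prodAssoc (α₁ := ℝ) (β₁ := ℝ) (γ₁ := ℝ × (ℝ × (Fin N → ℝ)))
  have h4 := mp_right (α := ℝ) (mp_right (α := ℝ) (mp_lc (α := ℝ) (β := ℝ) (γ := Fin N → ℝ)))
  have h5 := mp_right (α := ℝ) (mp_lc (α := ℝ) (β := ℝ) (γ := ℝ × (Fin N → ℝ)))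
  have h6 := mp_right (α := ℝ) (mp_right (α := ℝ) (mp_lc (α := ℝ) (β := ℝ) (γ := Fin N → ℝ)))
  have h7 := mp_lc (α := ℝ) (β := ℝ) (γ := ℝ × (ℝ × (Fin N → ℝ)))
  exact h7.comp (h6.comp (h5.comp (h4.comp (h3.comp (h2.comp h1)))))

lemma measurable_DD {N : ℕ} (x : Fin N → ℝ) (X Y : ℝ) :
    Measurable (fun z : ℝ × EE N => DD x X Y 1 z.1 z.2) := by
  unfold DD
  fun_prop

lemma eFun_eq (N : ℕ) (v : Fin (N + 2) → ℝ) :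
    eFun (N + 2) v = (∫⁻ t in Ioi (0:ℝ), ∫⁻ y, FF (-(((N + 2 : ℕ) : ℝ) + 3) / 2)
      (fun i => v i.castSucc.castSucc) (v (Fin.last N).castSucc) (v (Fin.last (N + 1)))
      1 t y).toReal := by
  set s : ℝ := -(((N + 2 : ℕ) : ℝ) + 3) / 2 with hs
  set x : Fin N → ℝ := fun i => v i.castSucc.castSucc with hx
  set X := v (Fin.last N).castSucc with hX
  set Y := v (Fin.last (N + 1)) with hY
  let T : Set (ℝ × EE N) := Ioi (0:ℝ) ×ˢ posS N
  have hT : MeasurableSet T := measurableSet_Ioi.prod (measurable_posS N)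
  have hset : ((Set.Ioi (0:ℝ) ×ˢ Set.Ioi (0:ℝ)) ×ˢ
      ((Set.univ : Set (Fin (N + 2))).pi fun _ => Set.Ioi (0:ℝ))) = phi N ⁻¹' T := by
    ext p
    simp only [T, posS, phi, mem_prod, mem_preimage, mem_pi, mem_univ, mem_Ioi, true_imp_iff,
      Fin.forall_fin_succ' (n := N + 1), Fin.forall_fin_succ' (n := N)]
    tauto
  have hf : ∀ p : (ℝ × ℝ) × (Fin (N + 2) → ℝ),
      ((1 + p.1.1 + ∑ i, p.2 i * v i ^ 2) * (1 + p.1.2 + ∑ i, p.2 i)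
        - (1 + ∑ i, p.2 i * v i) ^ 2) = DD x X Y 1 (phi N p).1 (phi N p).2 := by
    intro p
    simp only [Fin.sum_univ_castSucc (n := N + 1), Fin.sum_univ_castSucc (n := N), DD, phi]
    ring
  have hmeas : Measurable (fun z : ℝ × EE N => DD x X Y 1 z.1 z.2 ^ s) :=
    (measurable_DD x X Y).pow_const s
  unfold eFun
  simp only [hf]
  rw [hset, integral_eq_lintegral_of_nonneg_ae]
  · congr 1
    rw [(mp_phi N).setLIntegral_comp_preimage hT
      (f := fun z => ENNReal.ofReal (DD x X Y 1 z.1 z.2 ^ s)) hmeas.ennreal_ofReal]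
    rw [Measure.volume_eq_prod, ← Measure.prod_restrict, lintegral_prod]
    · refine lintegral_congr fun t => ?_
      simp only [FF]
      rw [lintegral_indicator (measurable_posS N)]
    · exact hmeas.ennreal_ofReal.aemeasurable
  · refine ae_restrict_of_forall_mem ((mp_phi N).measurable hT) ?_
    intro p hp
    exact Real.rpow_nonneg (DD_nonneg _ _ _ _ _ _ one_pos hp.1 hp.2) _
  · exact (hmeas.comp (mp_phi N).measurable).aestronglyMeasurable

def sig (N : ℕ) (d : ℝ) (y : EE N) : EE N :=
  (d ^ 2 * y.1, (y.2.2.1, (y.2.1, fun i => y.2.2.2 i.rev)))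

lemma mp_rev (N : ℕ) : MeasurePreserving (fun (h : Fin N → ℝ) (i : Fin N) => h i.rev)
    volume volume := by
  have := volume_preserving_arrowCongr' (Fin.revPerm (n := N)) (MeasurableEquiv.refl ℝ)
    (MeasurePreserving.id volume)
  exact this

lemma map_sig (N : ℕ) (d : ℝ) (hd : 0 < d) :
    Measure.map (sig N d) volume = ENNReal.ofReal ((d ^ 2)⁻¹) • (volume : Measure (EE N)) := by
  have h1 := (mp_lc (α := ℝ) (β := ℝ) (γ := Fin N → ℝ)).comp
    (mp_right (α := ℝ) (mp_right (α := ℝ) (mp_rev N)))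
  have h2 := Real.map_volume_mul_left (a := d ^ 2) (by positivity)
  have h3 := Measure.map_prod_map (volume : Measure ℝ)
    (volume : Measure (ℝ × (ℝ × (Fin N → ℝ)))) (measurable_const_mul (d ^ 2)) h1.measurable
  rw [h1.map_eq, h2, Measure.prod_smul_left, abs_of_pos (by positivity)] at h3
  exact h3.symm

lemma measurable_FF {N : ℕ} (s : ℝ) (x : Fin N → ℝ) (X Y a b : ℝ) :
    Measurable (FF s x X Y a b) := by
  unfold FF
  refine Measurable.indicator ?_ (measurable_posS N)
  refine (Measurable.pow_const ?_ s).ennreal_ofReal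
  unfold DD
  fun_prop

lemma lint_sig {N : ℕ} (d : ℝ) (hd : 0 < d) (f : EE N → ℝ≥0∞) (hf : Measurable f) :
    ∫⁻ y, f (sig N d y) = ENNReal.ofReal ((d ^ 2)⁻¹) * ∫⁻ y, f y := by
  have hm : Measurable (sig N d) := by
    unfold sig
    fun_prop
  rw [← lintegral_map hf hm, map_sig N d hd, lintegral_smul_measure, smul_eq_mul]

lemma FF_sig {N : ℕ} (s : ℝ) (x : Fin N → ℝ) (X Y t : ℝ) (hd : X < Y) (ht : 0 < t) (y : EE N) :
    FF s (fun i => (Y - x i.rev) / (Y - X)) ((Y - 1) / (Y - X)) (Y / (Y - X)) 1 t y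
      = ENNReal.ofReal ((((Y - X) ^ 2)⁻¹) ^ s) * FF s x X Y t 1 (sig N (Y - X) y) := by
  have hd' : 0 < Y - X := sub_pos.2 hd
  have hmem : sig N (Y - X) y ∈ posS N ↔ y ∈ posS N := by
    have : (∀ i : Fin N, 0 < y.2.2.2 i.rev) ↔ ∀ i, 0 < y.2.2.2 i :=
      ⟨fun h i => by simpa using h i.rev, fun h i => h _⟩
    have h2 : 0 < (Y - X) ^ 2 := by positivity
    simp only [posS, sig, mem_prod, mem_pi, mem_Ioi, mem_univ, true_imp_iff, this,
      mul_pos_iff_of_pos_left h2]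
    tauto
  by_cases hy : y ∈ posS N
  · have hD : DD (fun i => (Y - x i.rev) / (Y - X)) ((Y - 1) / (Y - X)) (Y / (Y - X)) 1 t y
        = ((Y - X) ^ 2)⁻¹ * DD x X Y t 1 (sig N (Y - X) y) := by
      simp only [DD, sig]
      have r0 : ∑ i : Fin N, y.2.2.2 i.rev = ∑ i, y.2.2.2 i :=
        Equiv.sum_comp Fin.revPerm (fun i => y.2.2.2 i)
      have r1 : ∑ i : Fin N, y.2.2.2 i.rev * x i = ∑ i, y.2.2.2 i * x i.rev := by
        rw [← Equiv.sum_comp Fin.revPerm]; simp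
      have r2 : ∑ i : Fin N, y.2.2.2 i.rev * x i ^ 2 = ∑ i, y.2.2.2 i * x i.rev ^ 2 := by
        rw [← Equiv.sum_comp Fin.revPerm]; simp
      have s1 : ∑ i : Fin N, y.2.2.2 i * ((Y - x i.rev) / (Y - X))
          = (Y * ∑ i, y.2.2.2 i - ∑ i, y.2.2.2 i * x i.rev) / (Y - X) := by
        rw [Finset.mul_sum, ← Finset.sum_sub_distrib, Finset.sum_div]
        exact Finset.sum_congr rfl fun i _ => by ring
      have s2 : ∑ i : Fin N, y.2.2.2 i * ((Y - x i.rev) / (Y - X)) ^ 2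
          = (Y ^ 2 * ∑ i, y.2.2.2 i - 2 * Y * ∑ i, y.2.2.2 i * x i.rev
              + ∑ i, y.2.2.2 i * x i.rev ^ 2) / (Y - X) ^ 2 := by
        rw [Finset.mul_sum, Finset.mul_sum, ← Finset.sum_sub_distrib, ← Finset.sum_add_distrib,
          Finset.sum_div]
        refine Finset.sum_congr rfl fun i _ => ?_
        rw [div_pow]
        ring
      rw [r0, r1, r2, s1, s2]
      generalize ∑ i, y.2.2.2 i = S0
      generalize ∑ i : Fin N, y.2.2.2 i * x i.rev = S1
      generalize ∑ i : Fin N, y.2.2.2 i * x i.rev ^ 2 = S2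
      have := hd'.ne'
      field_simp
      ring
    rw [FF, FF, indicator_of_mem hy, indicator_of_mem (hmem.2 hy),
      ← ENNReal.ofReal_mul (by positivity), hD,
      Real.mul_rpow (by positivity) (DD_nonneg x X Y t 1 _ ht one_pos (hmem.2 hy))]
  · rw [FF, FF, indicator_of_notMem hy, indicator_of_notMem (hmem.not.2 hy), mul_zero]

lemma haar_prod {α β : Type*} [NormedAddCommGroup α] [NormedAddCommGroup β]
    [MeasureSpace α] [MeasureSpace β] [BorelSpace α] [BorelSpace β]
    [SecondCountableTopology α] [SecondCountableTopology β]
    [SigmaFinite (volume : Measure α)] [SigmaFinite (volume : Measure β)]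
    (ha : (volume : Measure α).IsAddHaarMeasure) (hb : (volume : Measure β).IsAddHaarMeasure) :
    (volume : Measure (α × β)).IsAddHaarMeasure := by
  rw [Measure.volume_eq_prod]
  infer_instance

lemma haar_EE (N : ℕ) : (volume : Measure (EE N)).IsAddHaarMeasure :=
  haar_prod inferInstance (haar_prod inferInstance (haar_prod inferInstance inferInstance))

lemma main (N : ℕ) (x : Fin N → ℝ) (X Y : ℝ) (hd : X < Y) (v w : Fin (N + 2) → ℝ)
    (hw : ∀ i : Fin N, w i.castSucc.castSucc = x i) (hwX : w (Fin.last N).castSucc = X)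
    (hwY : w (Fin.last (N + 1)) = Y)
    (hv : ∀ i : Fin N, v i.castSucc.castSucc = (Y - x i.rev) / (Y - X))
    (hvX : v (Fin.last N).castSucc = (Y - 1) / (Y - X))
    (hvY : v (Fin.last (N + 1)) = Y / (Y - X)) :
    eFun (N + 2) v = (Y - X) ^ (N + 3) * eFun (N + 2) w := by
  have hd' : 0 < Y - X := sub_pos.2 hd
  haveI := haar_EE N
  rw [eFun_eq, eFun_eq]
  simp only [hw, hwX, hwY, hv, hvX, hvY]
  rw [proj_chart volume (FF (-(((N + 2 : ℕ) : ℝ) + 3) / 2) x X Y)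
    (fun r hr a b ha hb y => FF_hom x X Y r hr a b ha hb y)]
  set s : ℝ := -(((N + 2 : ℕ) : ℝ) + 3) / 2 with hs
  have h1 : ∫⁻ t in Ioi (0:ℝ), ∫⁻ y, FF s (fun i => (Y - x i.rev) / (Y - X))
        ((Y - 1) / (Y - X)) (Y / (Y - X)) 1 t y
      = ∫⁻ t in Ioi (0:ℝ), ENNReal.ofReal ((Y - X) ^ (N + 3)) * ∫⁻ y, FF s x X Y t 1 y := by
    refine setLIntegral_congr_fun measurableSet_Ioi ?_
    intro t ht
    simp only [FF_sig s x X Y t hd ht]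
    rw [lintegral_const_mul' _ _ ENNReal.ofReal_ne_top,
      lint_sig _ hd' _ (measurable_FF s x X Y t 1), ← mul_assoc,
      ← ENNReal.ofReal_mul (by positivity)]
    congr 2
    have e1 : ((Y - X) ^ 2)⁻¹ = (Y - X) ^ (-2 : ℝ) := by
      rw [Real.rpow_neg hd'.le]; norm_num
    rw [e1, ← Real.rpow_mul hd'.le, ← Real.rpow_add hd', ← Real.rpow_natCast]
    congr 1
    rw [hs]
    push_cast
    ring
  rw [h1, lintegral_const_mul' _ _ ENNReal.ofReal_ne_top, ENNReal.toReal_mul,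
    ENNReal.toReal_ofReal (by positivity)]

end EulerR

/-- the transformation formula for `e_{n−1}` under the dihedral reflection `R`.
Here `n ≥ 3`, `m = ⌊n/2⌋ = n/2` (natural division), the values `u₁,…,u_{m−1},u_{m+1},…,u_n`
(index `m` omitted) satisfy `1 < u₁ < … < u_{m−1} < u_{m+1} < … < u_n`, and `u₀ = 1`,
`u₋₁ = 0`.  Then `e_{n−1}(A) = (u_n − u_{n−1})ⁿ · e_{n−1}(u₁,…,û_m,…,u_n)` where `A` is the
`(n−1)`-tuple of entries `(u_n − u_j)/(u_n − u_{n−1})` for `j = n−2, n−3, …, 1, 0, −1` in this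
order, with the entry corresponding to `j = m` omitted. -/
theorem stmt10 (n : ℕ) (hn : 3 ≤ n) (u : ℤ → ℝ)
    (hu0 : u (-1) = 0) (hu1 : u 0 = 1)
    (hmono : ∀ i j : ℤ, 0 ≤ i → i < j → j ≤ (n : ℤ) →
      i ≠ ((n / 2 : ℕ) : ℤ) → j ≠ ((n / 2 : ℕ) : ℤ) → u i < u j) :
    eFun (n - 1) (fun k =>
        (u (n : ℤ) - u (if ((k : ℕ) : ℤ) < (n : ℤ) - 2 - ((n / 2 : ℕ) : ℤ)
            then (n : ℤ) - 2 - ((k : ℕ) : ℤ) else (n : ℤ) - 3 - ((k : ℕ) : ℤ)))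
          / (u (n : ℤ) - u ((n : ℤ) - 1)))
      = (u (n : ℤ) - u ((n : ℤ) - 1)) ^ n *
        eFun (n - 1) (fun k =>
          u (if ((k : ℕ) : ℤ) + 1 < ((n / 2 : ℕ) : ℤ)
            then ((k : ℕ) : ℤ) + 1 else ((k : ℕ) : ℤ) + 2)) := by
  obtain ⟨N, rfl⟩ : ∃ N, n = N + 3 := ⟨n - 3, by omega⟩
  have hm1 : 1 ≤ (N + 3) / 2 := by omega
  have hm2 : (N + 3) / 2 < N + 2 := by omega
  have hm2' : (N + 3) / 2 ≤ N + 1 := by omega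
  generalize (N + 3) / 2 = m at *
  have hlt : u (((N + 3 : ℕ) : ℤ) - 1) < u ((N + 3 : ℕ) : ℤ) := by
    apply hmono <;> push_cast <;> omega
  refine EulerR.main N (fun i => u (if ((i : ℕ) : ℤ) + 1 < (m : ℤ)
            then ((i : ℕ) : ℤ) + 1 else ((i : ℕ) : ℤ) + 2)) _ _ hlt _ _ ?_ ?_ ?_ ?_ ?_ ?_
  · intro i
    rfl
  · simp only [Fin.val_castSucc, Fin.val_last]
    rw [if_neg (by omega)]
    congr 1
    push_cast
    ring
  · simp only [Fin.val_last]
    rw [if_neg (by push_cast; omega)]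
    congr 1
  · intro i
    have hi := i.isLt
    simp only [Fin.val_castSucc, Fin.val_rev]
    congr 3
    split_ifs <;> push_cast at * <;> omega
  · simp only [Fin.val_castSucc, Fin.val_last]
    rw [if_neg (by push_cast; omega), ← hu1]
    congr 3
    push_cast
    ring
  · simp only [Fin.val_last]
    rw [if_neg (by push_cast; omega)]
    have : ((N + 3 : ℕ) : ℤ) - 3 - ((N + 1 : ℕ) : ℤ) = -1 := by push_cast; ring
    rw [this, hu0, sub_zero]
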